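/- Let σ ∈ S_n and let w be a reduced word for σ. Suppose r is a function assigning to every permutation γ with γ ≤ σ in the strong Bruhat order a reduced word r(γ) for γ. Then for every f ∈ R: π_w(f) = Σ_{γ ∈ S_n, γ ≤ σ} θ_{r(γ)}(f). -/

import Mathlib

open MvPolynomial

noncomputable section

/-- Valid indices: `i` with `i + 1 < n`. -/
abbrev Idx (n : ℕ) := {i : ℕ // i + 1 < n}

/-- The element `i` of `Fin n`. -/
def idxLow {n : ℕ} (i : Idx n) : Fin n := ⟨i.1, Nat.lt_of_succ_lt i.2⟩

/-- The element `i + 1` of `Fin n`. -/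
def idxHigh {n : ℕ} (i : Idx n) : Fin n := ⟨i.1 + 1, i.2⟩

/-- The simple transposition `s_i = (i, i+1)` in `S_n`. -/
def simpleT {n : ℕ} (i : Idx n) : Equiv.Perm (Fin n) := Equiv.swap (idxLow i) (idxHigh i)

/-- The action of `s_i` on polynomials, renaming the variables `X i` and `X (i+1)`. -/
def sOp {n : ℕ} (i : Idx n) (f : MvPolynomial (Fin n) ℤ) : MvPolynomial (Fin n) ℤ :=
  rename ⇑(simpleT i) f

/-- The type of families of operators indexed by valid indices. -/
abbrev DD (n : ℕ) := Idx n → MvPolynomial (Fin n) ℤ → MvPolynomial (Fin n) ℤ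

/-- `D` is the family of divided difference operators `∂_i`:
`(X i − X (i+1)) * ∂_i f = f − s_i f` (this determines `∂_i f` uniquely since
`MvPolynomial (Fin n) ℤ` is an integral domain). -/
def IsDividedDiff {n : ℕ} (D : DD n) : Prop :=
  ∀ (i : Idx n) (f : MvPolynomial (Fin n) ℤ),
    (X (idxLow i) - X (idxHigh i)) * D i f = f - sOp i f

/-- `π_i f = ∂_i (X i * f)`. -/
def piOp {n : ℕ} (D : DD n) (i : Idx n) (f : MvPolynomial (Fin n) ℤ) :
    MvPolynomial (Fin n) ℤ :=
  D i (X (idxLow i) * f)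

/-- `θ_i f = X (i+1) * ∂_i f`. -/
def thetaOp {n : ℕ} (D : DD n) (i : Idx n) (f : MvPolynomial (Fin n) ℤ) :
    MvPolynomial (Fin n) ℤ :=
  X (idxHigh i) * D i f

/-- `θ_w = θ_{i_1} ∘ ⋯ ∘ θ_{i_k}` for a word `w = (i_1, …, i_k)`. -/
def thetaWord {n : ℕ} (D : DD n) : List (Idx n) → MvPolynomial (Fin n) ℤ → MvPolynomial (Fin n) ℤ
  | [], f => f
  | i :: w, f => thetaOp D i (thetaWord D w f)

/-- `π_w = π_{i_1} ∘ ⋯ ∘ π_{i_k}` for a word `w = (i_1, …, i_k)`. -/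
def piWord {n : ℕ} (D : DD n) : List (Idx n) → MvPolynomial (Fin n) ℤ → MvPolynomial (Fin n) ℤ
  | [], f => f
  | i :: w, f => piOp D i (piWord D w f)

/-- The permutation `s_{i_1} · ⋯ · s_{i_k}` represented by a word. -/
def wordProd {n : ℕ} (w : List (Idx n)) : Equiv.Perm (Fin n) := (w.map simpleT).prod

/-- `w` is a reduced word for `σ`: it represents `σ` and no shorter word does. -/
def IsReducedWord {n : ℕ} (w : List (Idx n)) (σ : Equiv.Perm (Fin n)) : Prop :=
  wordProd w = σ ∧ ∀ w' : List (Idx n), wordProd w' = σ → w.length ≤ w'.length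

/-- The length `l(σ)`: the length of any reduced word for `σ`. -/
def len {n : ℕ} (σ : Equiv.Perm (Fin n)) : ℕ :=
  sInf {k | ∃ w : List (Idx n), wordProd w = σ ∧ w.length = k}

/-- Strong Bruhat order: some reduced word of `γ` is a (not necessarily contiguous)
subword of some reduced word of `σ`. -/
def BruhatLE {n : ℕ} (γ σ : Equiv.Perm (Fin n)) : Prop :=
  ∃ u v : List (Idx n), IsReducedWord u γ ∧ IsReducedWord v σ ∧ u.Sublist v

/-- The monomial `x^λ = ∏ j, (X j)^(λ j)`. -/
def xpow {n : ℕ} (lam : Fin n → ℕ) : MvPolynomial (Fin n) ℤ := ∏ j, X j ^ lam j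

/-- `f` is atom-positive: it lies in the additive submonoid generated by the
Demazure atoms `θ_w (x^λ)` with `w` a reduced word and `λ` a partition. -/
def AtomPos {n : ℕ} (D : DD n) (f : MvPolynomial (Fin n) ℤ) : Prop :=
  f ∈ AddSubmonoid.closure {g : MvPolynomial (Fin n) ℤ |
    ∃ (w : List (Idx n)) (σ : Equiv.Perm (Fin n)) (lam : Fin n → ℕ),
      IsReducedWord w σ ∧ Antitone lam ∧ g = thetaWord D w (xpow lam)}

/-- `f` is key-positive: it lies in the additive submonoid generated by the
key polynomials `π_w (x^λ)` with `w` a word and `λ` a partition. -/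
def KeyPos {n : ℕ} (D : DD n) (f : MvPolynomial (Fin n) ℤ) : Prop :=
  f ∈ AddSubmonoid.closure {g : MvPolynomial (Fin n) ℤ |
    ∃ (w : List (Idx n)) (lam : Fin n → ℕ),
      Antitone lam ∧ g = piWord D w (xpow lam)}

/-- The number of inversions of a permutation. -/
def invNum {n : ℕ} (σ : Equiv.Perm (Fin n)) : ℕ :=
  (Finset.univ.filter (fun p : Fin n × Fin n => p.1 < p.2 ∧ σ p.2 < σ p.1)).card

end

section Words

variable {n : ℕ}

theorem simpleT_mul_self (i : Idx n) : simpleT i * simpleT i = 1 :=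
  Equiv.swap_mul_self _ _

theorem simpleT_inv (i : Idx n) : (simpleT i)⁻¹ = simpleT i :=
  Equiv.swap_inv _ _

theorem simpleT_mul_simpleT_mul (i : Idx n) (γ : Equiv.Perm (Fin n)) :
    simpleT i * (simpleT i * γ) = γ := by
  rw [← mul_assoc, simpleT_mul_self, one_mul]

theorem wordProd_nil : wordProd ([] : List (Idx n)) = 1 := rfl

theorem wordProd_cons (i : Idx n) (w : List (Idx n)) :
    wordProd (i :: w) = simpleT i * wordProd w := by
  simp [wordProd]

/-- Distant simple transpositions commute. -/
theorem simpleT_comm {i j : Idx n} (h : i.1 + 1 < j.1) :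
    simpleT i * simpleT j = simpleT j * simpleT i := by
  ext x
  simp only [simpleT, Equiv.Perm.mul_apply, Equiv.swap_apply_def, idxLow, idxHigh, Fin.ext_iff]
  grind

/-- Adjacent simple transpositions satisfy the braid relation. -/
theorem simpleT_braid {i j : Idx n} (h : i.1 + 1 = j.1) :
    simpleT i * simpleT j * simpleT i = simpleT j * simpleT i * simpleT j := by
  ext x
  simp only [simpleT, Equiv.Perm.mul_apply, Equiv.swap_apply_def, idxLow, idxHigh, Fin.ext_iff]
  grind

/-- `i` is a left descent of `γ`. -/
def IsLeftDescent (i : Idx n) (γ : Equiv.Perm (Fin n)) : Prop :=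
  γ⁻¹ (idxHigh i) < γ⁻¹ (idxLow i)

theorem idxLow_ne_idxHigh (i : Idx n) : idxLow i ≠ idxHigh i := by
  simp [idxLow, idxHigh, Fin.ext_iff]

theorem isLeftDescent_simpleT_mul (i : Idx n) (γ : Equiv.Perm (Fin n)) :
    IsLeftDescent i (simpleT i * γ) ↔ ¬ IsLeftDescent i γ := by
  have hne : γ⁻¹ (idxLow i) ≠ γ⁻¹ (idxHigh i) := fun h =>
    idxLow_ne_idxHigh i (γ⁻¹.injective h)
  simp only [IsLeftDescent, mul_inv_rev, simpleT_inv, Equiv.Perm.mul_apply]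
  simp only [simpleT, Equiv.swap_apply_left, Equiv.swap_apply_right]
  grind

/-- The strong exchange property, for the transposition of `a < b`. -/
theorem exists_sublist_swap_mul (w : List (Idx n)) :
    ∀ a b : Fin n, a < b → (wordProd w)⁻¹ b < (wordProd w)⁻¹ a →
      ∃ u : List (Idx n), u.Sublist w ∧ u.length + 1 = w.length ∧
        wordProd u = Equiv.swap a b * wordProd w := by
  induction w with
  | nil =>
    intro a b hab h
    simp only [wordProd_nil, inv_one, Equiv.Perm.one_apply] at h
    exact absurd hab h.asymm
  | cons j w ih =>
    intro a b hab h
    have hswap : Equiv.swap a b * simpleT j =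
        simpleT j * Equiv.swap (simpleT j a) (simpleT j b) := by
      have h := Equiv.mul_swap_eq_swap_mul (simpleT j) (simpleT j a) (simpleT j b)
      rw [h, ← Equiv.Perm.mul_apply, ← Equiv.Perm.mul_apply, simpleT_mul_self]
      rfl
    rw [wordProd_cons] at h ⊢
    rw [mul_inv_rev, simpleT_inv, Equiv.Perm.mul_apply, Equiv.Perm.mul_apply] at h
    by_cases hlt : simpleT j a < simpleT j b
    · obtain ⟨u, hu, hlen, hprod⟩ := ih _ _ hlt h
      refine ⟨j :: u, hu.cons_cons j, by simp [hlen], ?_⟩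
      rw [wordProd_cons, hprod, ← mul_assoc, ← mul_assoc, hswap]
    · have hab' : a = idxLow j ∧ b = idxHigh j := by
        simp only [simpleT, Equiv.swap_apply_def, idxLow, idxHigh, Fin.ext_iff,
          Fin.lt_def] at hlt hab ⊢
        grind
      refine ⟨w, List.sublist_cons_self j w, rfl, ?_⟩
      rw [hab'.1, hab'.2]
      exact (simpleT_mul_simpleT_mul j _).symm

/-- The exchange property for simple transpositions. -/
theorem IsLeftDescent.exists_sublist {i : Idx n} {w : List (Idx n)}
    (h : IsLeftDescent i (wordProd w)) :
    ∃ u : List (Idx n), u.Sublist w ∧ u.length + 1 = w.length ∧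
      wordProd u = simpleT i * wordProd w :=
  exists_sublist_swap_mul w _ _ (by simp [idxLow, idxHigh, Fin.lt_def]) h

theorem IsReducedWord.tail {i : Idx n} {w : List (Idx n)}
    (h : IsReducedWord (i :: w) (wordProd (i :: w))) : IsReducedWord w (wordProd w) := by
  refine ⟨rfl, fun v hv => ?_⟩
  have := h.2 (i :: v) (by rw [wordProd_cons, wordProd_cons, hv])
  simpa using this

theorem IsReducedWord.cons {i : Idx n} {w : List (Idx n)} {γ : Equiv.Perm (Fin n)}
    (h : IsReducedWord w γ) (hi : ¬ IsLeftDescent i γ) :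
    IsReducedWord (i :: w) (simpleT i * γ) := by
  refine ⟨by rw [wordProd_cons, h.1], fun v hv => ?_⟩
  obtain ⟨u, -, hlen, hu⟩ := IsLeftDescent.exists_sublist (i := i) (w := v)
    (by rw [hv]; exact (isLeftDescent_simpleT_mul i γ).2 hi)
  rw [hv, simpleT_mul_simpleT_mul] at hu
  have := h.2 u hu
  simp only [List.length_cons]
  omega

theorem IsReducedWord.isLeftDescent {i : Idx n} {w : List (Idx n)} {γ : Equiv.Perm (Fin n)}
    (h : IsReducedWord (i :: w) γ) : IsLeftDescent i γ := by
  by_contra hi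
  have h1 := (h.cons hi).2 w (by rw [← h.1, wordProd_cons, simpleT_mul_simpleT_mul])
  simp only [List.length_cons] at h1
  omega

theorem IsReducedWord.exists_cons {i : Idx n} {w : List (Idx n)} {γ : Equiv.Perm (Fin n)}
    (h : IsReducedWord w γ) (hi : IsLeftDescent i γ) :
    ∃ u : List (Idx n), IsReducedWord u (simpleT i * γ) ∧ IsReducedWord (i :: u) γ := by
  obtain ⟨u, -, hlen, hu⟩ := IsLeftDescent.exists_sublist (i := i) (w := w) (by rwa [h.1])
  rw [h.1] at hu
  have hprod : wordProd (i :: u) = γ := by rw [wordProd_cons, hu, simpleT_mul_simpleT_mul]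
  have hred : IsReducedWord (i :: u) γ :=
    ⟨hprod, fun v hv => by rw [List.length_cons, hlen]; exact h.2 v hv⟩
  refine ⟨u, ?_, hred⟩
  rw [← hu]
  exact IsReducedWord.tail (i := i) (by rwa [hprod])

/-- The deletion property: every word contains a reduced subword with the same product. -/
theorem exists_reduced_sublist (w : List (Idx n)) :
    ∃ u : List (Idx n), u.Sublist w ∧ IsReducedWord u (wordProd w) := by
  induction w with
  | nil => exact ⟨[], List.Sublist.refl _, rfl, fun _ _ => Nat.zero_le _⟩
  | cons i w ih =>
    obtain ⟨u, hu, hred⟩ := ih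
    rw [wordProd_cons]
    by_cases hi : IsLeftDescent i (wordProd w)
    · obtain ⟨v, hv, hlen, hprod⟩ :=
        IsLeftDescent.exists_sublist (i := i) (w := u) (by rwa [hred.1])
      rw [hred.1] at hprod
      refine ⟨v, (hv.trans hu).cons i, hprod, fun x hx => ?_⟩
      have := hred.2 (i :: x) (by rw [wordProd_cons, hx, simpleT_mul_simpleT_mul])
      simp only [List.length_cons] at this
      omega
    · exact ⟨i :: u, hu.cons_cons i, hred.cons hi⟩

/-- If `i` and `j` are distant left descents, then some reduced words start with `i j` and `j i`
and agree afterwards. -/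
theorem IsReducedWord.exists_comm {i j : Idx n} {w : List (Idx n)} {σ : Equiv.Perm (Fin n)}
    (h : IsReducedWord w σ) (hij : i.1 + 1 < j.1) (hi : IsLeftDescent i σ)
    (hj : IsLeftDescent j σ) :
    ∃ x : List (Idx n), IsReducedWord (i :: j :: x) σ ∧ IsReducedWord (j :: i :: x) σ := by
  obtain ⟨u, hu, hiu⟩ := h.exists_cons hi
  have hj' : IsLeftDescent j (simpleT i * σ) := by
    have h1 : simpleT i (idxLow j) = idxLow j := by
      simp only [simpleT, Equiv.swap_apply_def, idxLow, idxHigh, Fin.ext_iff]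
      grind
    have h2 : simpleT i (idxHigh j) = idxHigh j := by
      simp only [simpleT, Equiv.swap_apply_def, idxLow, idxHigh, Fin.ext_iff]
      grind
    simpa only [IsLeftDescent, mul_inv_rev, simpleT_inv, Equiv.Perm.mul_apply, h1, h2] using hj
  obtain ⟨x, -, hx⟩ := hu.exists_cons hj'
  have hprod : wordProd (i :: j :: x) = σ := by
    rw [wordProd_cons, hx.1, simpleT_mul_simpleT_mul]
  have hlen : x.length + 1 = u.length :=
    le_antisymm (hx.2 u hu.1) (hu.2 (j :: x) hx.1)
  refine ⟨x, ⟨hprod, fun v hv => ?_⟩, ?_, fun v hv => ?_⟩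
  · have := hiu.2 v hv
    simp only [List.length_cons] at this ⊢
    omega
  · rw [← hprod]
    simp only [wordProd_cons, ← mul_assoc, simpleT_comm hij]
  · have := hiu.2 v hv
    simp only [List.length_cons] at this ⊢
    omega

/-- If `i` and `j = i + 1` are left descents, then some reduced words start with `i j i` and
`j i j` and agree afterwards. -/
theorem IsReducedWord.exists_braid {i j : Idx n} {w : List (Idx n)} {σ : Equiv.Perm (Fin n)}
    (h : IsReducedWord w σ) (hij : i.1 + 1 = j.1) (hi : IsLeftDescent i σ)
    (hj : IsLeftDescent j σ) :
    ∃ x : List (Idx n), IsReducedWord (i :: j :: i :: x) σ ∧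
      IsReducedWord (j :: i :: j :: x) σ := by
  have hmid : idxHigh i = idxLow j := Fin.ext hij
  have hlow : simpleT j (idxLow i) = idxLow i := by
    simp only [simpleT, Equiv.swap_apply_def, idxLow, idxHigh, Fin.ext_iff]
    grind
  have hhigh : simpleT i (idxHigh j) = idxHigh j := by
    simp only [simpleT, Equiv.swap_apply_def, idxLow, idxHigh, Fin.ext_iff]
    grind
  have hi1 : simpleT i (idxLow i) = idxLow j := by
    rw [← hmid]; exact Equiv.swap_apply_left _ _
  have hi2 : simpleT i (idxLow j) = idxLow i := by
    rw [← hmid]; exact Equiv.swap_apply_right _ _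
  have hj1 : simpleT j (idxLow j) = idxHigh j := Equiv.swap_apply_left _ _
  obtain ⟨u, hu, hiu⟩ := h.exists_cons hi
  have hj' : IsLeftDescent j (simpleT i * σ) := by
    simp only [IsLeftDescent, mul_inv_rev, simpleT_inv, Equiv.Perm.mul_apply, hi2, hhigh]
    simp only [IsLeftDescent, hmid] at hi hj
    exact hj.trans hi
  obtain ⟨y, hy, hjy⟩ := hu.exists_cons hj'
  have hi' : IsLeftDescent i (simpleT j * (simpleT i * σ)) := by
    simp only [IsLeftDescent, mul_inv_rev, simpleT_inv, Equiv.Perm.mul_apply, hmid, hj1, hhigh,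
      hlow, hi1]
    exact hj
  obtain ⟨x, -, hx⟩ := hy.exists_cons hi'
  have hprod : wordProd (i :: j :: i :: x) = σ := by
    rw [wordProd_cons, wordProd_cons, hx.1, simpleT_mul_simpleT_mul, simpleT_mul_simpleT_mul]
  have hlen : x.length + 1 = y.length :=
    le_antisymm (hx.2 y hy.1) (hy.2 (i :: x) hx.1)
  have hlen' : y.length + 1 = u.length :=
    le_antisymm (hjy.2 u hu.1) (hu.2 (j :: y) hjy.1)
  refine ⟨x, ⟨hprod, fun v hv => ?_⟩, ?_, fun v hv => ?_⟩
  · have := hiu.2 v hv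
    simp only [List.length_cons] at this ⊢
    omega
  · rw [← hprod]
    simp only [wordProd_cons, ← mul_assoc, simpleT_braid hij]
  · have := hiu.2 v hv
    simp only [List.length_cons] at this ⊢
    omega

/-- Matsumoto's theorem for the symmetric group: a family satisfying the braid relations has the
same product along any two reduced words of a permutation. -/
theorem matsumoto {M : Type*} [Monoid M] (g : Idx n → M)
    (hcomm : ∀ i j : Idx n, i.1 + 1 < j.1 → g i * g j = g j * g i)
    (hbraid : ∀ i j : Idx n, i.1 + 1 = j.1 → g i * g j * g i = g j * g i * g j)
    (u v : List (Idx n)) (σ : Equiv.Perm (Fin n)) (hu : IsReducedWord u σ)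
    (hv : IsReducedWord v σ) : (u.map g).prod = (v.map g).prod := by
  induction hk : u.length generalizing u v σ with
  | zero =>
    have hvk : v.length ≤ 0 := hk ▸ hv.2 u hu.1
    rw [List.length_eq_zero_iff.1 hk, List.length_eq_zero_iff.1 (Nat.le_zero.1 hvk)]
  | succ k ih =>
    have hvk : v.length = k + 1 := hk ▸ le_antisymm (hv.2 u hu.1) (hu.2 v hv.1)
    have same : ∀ (i : Idx n) (a b : List (Idx n)), a.length = k →
        IsReducedWord (i :: a) σ → IsReducedWord (i :: b) σ →
        ((i :: a).map g).prod = ((i :: b).map g).prod := by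
      intro i a b ha hia hib
      have hab : wordProd b = wordProd a := by
        have h := hia.1.trans hib.1.symm
        rw [wordProd_cons, wordProd_cons] at h
        exact (mul_left_cancel h).symm
      have hra : IsReducedWord a (wordProd a) := IsReducedWord.tail (i := i) (by rwa [hia.1])
      have hrb : IsReducedWord b (wordProd a) := by
        rw [← hab]
        exact IsReducedWord.tail (i := i) (by rwa [hib.1])
      rw [List.map_cons, List.map_cons, List.prod_cons, List.prod_cons, ih a b _ hra hrb ha]
    have key : ∀ (i j : Idx n) (a b : List (Idx n)), i.1 < j.1 → a.length = k → b.length = k →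
        IsReducedWord (i :: a) σ → IsReducedWord (j :: b) σ →
        ((i :: a).map g).prod = ((j :: b).map g).prod := by
      intro i j a b hij ha hb hia hjb
      rcases (Nat.succ_le_of_lt hij).eq_or_lt with h | h
      · obtain ⟨x, hx, hx'⟩ := hia.exists_braid h hia.isLeftDescent hjb.isLeftDescent
        rw [same i _ _ ha hia hx, same j _ _ hb hjb hx']
        simp only [List.map_cons, List.prod_cons, ← mul_assoc, hbraid i j h]
      · obtain ⟨x, hx, hx'⟩ := hia.exists_comm h hia.isLeftDescent hjb.isLeftDescent
        rw [same i _ _ ha hia hx, same j _ _ hb hjb hx']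
        simp only [List.map_cons, List.prod_cons, ← mul_assoc, hcomm i j h]
    match u, v, hk, hvk with
    | i :: a, j :: b, hk, hvk =>
      have ha : a.length = k := by simpa using hk
      have hb : b.length = k := by simpa using hvk
      rcases lt_trichotomy i.1 j.1 with h | h | h
      · exact key i j a b h ha hb hu hv
      · obtain rfl : i = j := Subtype.ext h
        exact same i a b ha hu hv
      · exact (key j i b a h hb ha hv hu).symm

/-- The products of all subwords of `w`. -/
def subwordProds (w : List (Idx n)) : Set (Equiv.Perm (Fin n)) :=
  {γ | ∃ u : List (Idx n), u.Sublist w ∧ wordProd u = γ}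

theorem mem_subwordProds_cons {i : Idx n} {w : List (Idx n)} {γ : Equiv.Perm (Fin n)} :
    γ ∈ subwordProds (i :: w) ↔ γ ∈ subwordProds w ∨ simpleT i * γ ∈ subwordProds w := by
  constructor
  · rintro ⟨u, hu, rfl⟩
    rcases List.sublist_cons_iff.1 hu with h | ⟨r, rfl, h⟩
    · exact Or.inl ⟨u, h, rfl⟩
    · exact Or.inr ⟨r, h, by rw [wordProd_cons, simpleT_mul_simpleT_mul]⟩
  · rintro (⟨u, hu, rfl⟩ | ⟨u, hu, h⟩)
    · exact ⟨u, hu.cons i, rfl⟩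
    · exact ⟨i :: u, hu.cons_cons i, by rw [wordProd_cons, h, simpleT_mul_simpleT_mul]⟩

open scoped Pointwise in
theorem subwordProds_eq_prod (w : List (Idx n)) :
    subwordProds w = (w.map fun i => ({1, simpleT i} : Set (Equiv.Perm (Fin n)))).prod := by
  induction w with
  | nil =>
    ext γ
    simp [subwordProds, wordProd_nil, eq_comm]
  | cons i w ih =>
    ext γ
    rw [mem_subwordProds_cons, ih, List.map_cons, List.prod_cons, Set.insert_eq, Set.union_mul,
      Set.singleton_mul, Set.singleton_mul]
    have : simpleT i * γ = (simpleT i)⁻¹ * γ := by rw [simpleT_inv]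
    rw [this]
    simp

open scoped Pointwise in
/-- The products of subwords of a reduced word depend only on the permutation. -/
theorem subwordProds_eq_of_isReducedWord {u v : List (Idx n)} {σ : Equiv.Perm (Fin n)}
    (hu : IsReducedWord u σ) (hv : IsReducedWord v σ) : subwordProds u = subwordProds v := by
  rw [subwordProds_eq_prod, subwordProds_eq_prod]
  refine matsumoto _ (fun i j h => ?_) (fun i j h => ?_) u v σ hu hv
  · have := simpleT_comm h
    simp only [Set.insert_eq, Set.union_mul, Set.mul_union, Set.singleton_mul_singleton, mul_one,
      one_mul, this]
    ext; simp only [Set.mem_union, Set.mem_singleton_iff]; tauto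
  · have := simpleT_braid h
    simp only [Set.insert_eq, Set.union_mul, Set.mul_union, Set.singleton_mul_singleton, mul_one,
      one_mul, this, simpleT_mul_self]
    ext; simp only [Set.mem_union, Set.mem_singleton_iff]; tauto

/-- The subword property of the Bruhat order. -/
theorem bruhatLE_iff_mem_subwordProds {w : List (Idx n)} {γ σ : Equiv.Perm (Fin n)}
    (hw : IsReducedWord w σ) : BruhatLE γ σ ↔ γ ∈ subwordProds w := by
  constructor
  · rintro ⟨u, v, hu, hv, huv⟩
    rw [subwordProds_eq_of_isReducedWord hw hv]
    exact ⟨u, huv, hu.1⟩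
  · rintro ⟨u, hu, rfl⟩
    obtain ⟨v, hv, hred⟩ := exists_reduced_sublist u
    exact ⟨v, w, hred, hw, hv.trans hu⟩

theorem simpleT_mul_mem_subwordProds {i : Idx n} {w : List (Idx n)} {γ : Equiv.Perm (Fin n)}
    (h : γ ∈ subwordProds w) (hi : IsLeftDescent i γ) : simpleT i * γ ∈ subwordProds w := by
  obtain ⟨u, hu, rfl⟩ := h
  obtain ⟨v, hv, -, hprod⟩ := hi.exists_sublist
  exact ⟨v, hv.trans hu, hprod⟩

theorem exists_isReducedWord_of_mem_subwordProds {w : List (Idx n)} {γ : Equiv.Perm (Fin n)}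
    (h : γ ∈ subwordProds w) : ∃ u : List (Idx n), IsReducedWord u γ := by
  obtain ⟨u, -, rfl⟩ := h
  obtain ⟨v, -, hv⟩ := exists_reduced_sublist u
  exact ⟨v, hv⟩

end Words

section Operators

variable {n : ℕ} {D : DD n}

theorem X_idxLow_sub_X_idxHigh_ne_zero (i : Idx n) :
    (X (idxLow i) - X (idxHigh i) : MvPolynomial (Fin n) ℤ) ≠ 0 :=
  sub_ne_zero.2 fun h => idxLow_ne_idxHigh i (X_injective h)

theorem thetaOp_spec (hD : IsDividedDiff D) (i : Idx n) (f : MvPolynomial (Fin n) ℤ) :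
    (X (idxLow i) - X (idxHigh i)) * thetaOp D i f = X (idxHigh i) * (f - sOp i f) := by
  rw [← hD, thetaOp]
  ring

theorem sOp_X (i : Idx n) (a : Fin n) : sOp i (X a) = X (simpleT i a) := rename_X _ _

theorem sOp_mul (i : Idx n) (f g : MvPolynomial (Fin n) ℤ) :
    sOp i (f * g) = sOp i f * sOp i g := map_mul _ _ _

theorem sOp_add (i : Idx n) (f g : MvPolynomial (Fin n) ℤ) :
    sOp i (f + g) = sOp i f + sOp i g := map_add _ _ _

theorem sOp_sub (i : Idx n) (f g : MvPolynomial (Fin n) ℤ) :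
    sOp i (f - g) = sOp i f - sOp i g := map_sub _ _ _

theorem sOp_sOp (i j : Idx n) (f : MvPolynomial (Fin n) ℤ) :
    sOp i (sOp j f) = rename ⇑(simpleT i * simpleT j) f := by
  rw [sOp, sOp, rename_rename]
  rfl

theorem sOp_sOp_self (i : Idx n) (f : MvPolynomial (Fin n) ℤ) : sOp i (sOp i f) = f := by
  rw [sOp_sOp, simpleT_mul_self]
  exact rename_id_apply f

theorem sOp_comm {i j : Idx n} (h : i.1 + 1 < j.1) (f : MvPolynomial (Fin n) ℤ) :
    sOp i (sOp j f) = sOp j (sOp i f) := by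
  rw [sOp_sOp, sOp_sOp, simpleT_comm h]

theorem sOp_braid {i j : Idx n} (h : i.1 + 1 = j.1) (f : MvPolynomial (Fin n) ℤ) :
    sOp i (sOp j (sOp i f)) = sOp j (sOp i (sOp j f)) := by
  have := simpleT_braid h
  rw [sOp_sOp j i, sOp_sOp i j, sOp, sOp, rename_rename, rename_rename, ← Equiv.Perm.coe_mul,
    ← Equiv.Perm.coe_mul, ← mul_assoc, ← mul_assoc, this]

theorem thetaOp_add (hD : IsDividedDiff D) (i : Idx n) (f g : MvPolynomial (Fin n) ℤ) :
    thetaOp D i (f + g) = thetaOp D i f + thetaOp D i g := by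
  apply mul_left_cancel₀ (X_idxLow_sub_X_idxHigh_ne_zero i)
  rw [mul_add, thetaOp_spec hD, thetaOp_spec hD, thetaOp_spec hD, sOp_add]
  ring

theorem thetaOp_sum (hD : IsDividedDiff D) (i : Idx n) {ι : Type*} (s : Finset ι)
    (F : ι → MvPolynomial (Fin n) ℤ) :
    thetaOp D i (∑ a ∈ s, F a) = ∑ a ∈ s, thetaOp D i (F a) :=
  map_sum (AddMonoidHom.mk' (thetaOp D i) (thetaOp_add hD i)) F s

theorem piOp_eq (hD : IsDividedDiff D) (i : Idx n) (f : MvPolynomial (Fin n) ℤ) :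
    piOp D i f = f + thetaOp D i f := by
  apply mul_left_cancel₀ (X_idxLow_sub_X_idxHigh_ne_zero i)
  have hX : sOp i (X (idxLow i)) = X (idxHigh i) := by
    rw [sOp_X, simpleT, Equiv.swap_apply_left]
  rw [mul_add, thetaOp_spec hD, piOp, hD, sOp_mul, hX]
  ring

/-- `θ_i² = -θ_i`. -/
theorem thetaOp_thetaOp (hD : IsDividedDiff D) (i : Idx n) (f : MvPolynomial (Fin n) ℤ) :
    thetaOp D i (thetaOp D i f) = -thetaOp D i f := by
  have h1 := thetaOp_spec hD i f
  have h2 := thetaOp_spec hD i (thetaOp D i f)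
  have h3 := congrArg (sOp i) h1
  simp only [sOp_mul, sOp_sub, sOp_X, sOp_sOp_self, simpleT, Equiv.swap_apply_left,
    Equiv.swap_apply_right] at h3
  have hne := X_idxLow_sub_X_idxHigh_ne_zero i
  apply mul_left_cancel₀ (mul_ne_zero hne hne)
  generalize (X (idxLow i) : MvPolynomial (Fin n) ℤ) = x at *
  generalize (X (idxHigh i) : MvPolynomial (Fin n) ℤ) = y at *
  linear_combination (x - y) * h2 + y * h3 + x * h1

theorem thetaOp_comm (hD : IsDividedDiff D) {i j : Idx n} (h : i.1 + 1 < j.1)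
    (f : MvPolynomial (Fin n) ℤ) :
    thetaOp D i (thetaOp D j f) = thetaOp D j (thetaOp D i f) := by
  have hi1 : simpleT i (idxLow j) = idxLow j := by
    simp only [simpleT, Equiv.swap_apply_def, idxLow, idxHigh, Fin.ext_iff]
    grind
  have hi2 : simpleT i (idxHigh j) = idxHigh j := by
    simp only [simpleT, Equiv.swap_apply_def, idxLow, idxHigh, Fin.ext_iff]
    grind
  have hj1 : simpleT j (idxLow i) = idxLow i := by
    simp only [simpleT, Equiv.swap_apply_def, idxLow, idxHigh, Fin.ext_iff]
    grind
  have hj2 : simpleT j (idxHigh i) = idxHigh i := by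
    simp only [simpleT, Equiv.swap_apply_def, idxLow, idxHigh, Fin.ext_iff]
    grind
  have e1 := thetaOp_spec hD i f
  have e2 := thetaOp_spec hD j f
  have e3 := thetaOp_spec hD i (thetaOp D j f)
  have e4 := thetaOp_spec hD j (thetaOp D i f)
  have e5 := congrArg (sOp j) e1
  have e6 := congrArg (sOp i) e2
  simp only [sOp_mul, sOp_sub, sOp_X, hi1, hi2, hj1, hj2, sOp_comm h] at e5 e6
  apply mul_left_cancel₀ (mul_ne_zero (X_idxLow_sub_X_idxHigh_ne_zero i)
    (X_idxLow_sub_X_idxHigh_ne_zero j))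
  generalize (X (idxLow i) : MvPolynomial (Fin n) ℤ) = x at *
  generalize (X (idxHigh i) : MvPolynomial (Fin n) ℤ) = y at *
  generalize (X (idxLow j) : MvPolynomial (Fin n) ℤ) = z at *
  generalize (X (idxHigh j) : MvPolynomial (Fin n) ℤ) = w at *
  linear_combination (z - w) * e3 - (x - y) * e4 + y * e2 - y * e6 - w * e1 + w * e5

theorem thetaOp_braid (hD : IsDividedDiff D) {i j : Idx n} (h : i.1 + 1 = j.1)
    (f : MvPolynomial (Fin n) ℤ) :
    thetaOp D i (thetaOp D j (thetaOp D i f)) = thetaOp D j (thetaOp D i (thetaOp D j f)) := by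
  have hmid : idxHigh i = idxLow j := Fin.ext h
  have hlow : simpleT j (idxLow i) = idxLow i := by
    simp only [simpleT, Equiv.swap_apply_def, idxLow, idxHigh, Fin.ext_iff]
    grind
  have hhigh : simpleT i (idxHigh j) = idxHigh j := by
    simp only [simpleT, Equiv.swap_apply_def, idxLow, idxHigh, Fin.ext_iff]
    grind
  have hi1 : simpleT i (idxLow i) = idxLow j := by
    rw [← hmid]; exact Equiv.swap_apply_left _ _
  have hi2 : simpleT i (idxLow j) = idxLow i := by
    rw [← hmid]; exact Equiv.swap_apply_right _ _
  have hj1 : simpleT j (idxLow j) = idxHigh j := Equiv.swap_apply_left _ _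
  have hj2 : simpleT j (idxHigh j) = idxLow j := Equiv.swap_apply_right _ _
  have hne1 := X_idxLow_sub_X_idxHigh_ne_zero i
  have hne2 := X_idxLow_sub_X_idxHigh_ne_zero j
  have hne3 : (X (idxLow i) - X (idxHigh j) : MvPolynomial (Fin n) ℤ) ≠ 0 :=
    sub_ne_zero.2 fun hX => by
      have := congrArg Fin.val (X_injective hX)
      simp only [idxLow, idxHigh] at this
      omega
  have e1 := thetaOp_spec hD i f
  have e2 := thetaOp_spec hD j (thetaOp D i f)
  have e3 := thetaOp_spec hD i (thetaOp D j (thetaOp D i f))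
  have e4 := congrArg (sOp j) e1
  have e5 := congrArg (sOp i) e1
  have e6 := congrArg (sOp i) e4
  have e7 := congrArg (sOp i) e2
  have g1 := thetaOp_spec hD j f
  have g2 := thetaOp_spec hD i (thetaOp D j f)
  have g3 := thetaOp_spec hD j (thetaOp D i (thetaOp D j f))
  have g4 := congrArg (sOp i) g1
  have g5 := congrArg (sOp j) g1
  have g6 := congrArg (sOp j) g4
  have g7 := congrArg (sOp j) g2
  simp only [sOp_mul, sOp_sub, sOp_X, sOp_sOp_self, hmid, hlow, hhigh, hi1, hi2, hj1, hj2,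
    sOp_braid h] at *
  have hne : (X (idxLow i) - X (idxLow j)) ^ 2 * (X (idxLow j) - X (idxHigh j)) ^ 2 *
      (X (idxLow i) - X (idxHigh j)) ≠ (0 : MvPolynomial (Fin n) ℤ) :=
    mul_ne_zero (mul_ne_zero (pow_ne_zero 2 hne1) (pow_ne_zero 2 hne2)) hne3
  apply mul_left_cancel₀ hne
  generalize (X (idxLow i) : MvPolynomial (Fin n) ℤ) = x at *
  generalize (X (idxLow j) : MvPolynomial (Fin n) ℤ) = y at *
  generalize (X (idxHigh j) : MvPolynomial (Fin n) ℤ) = z at *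
  linear_combination
    (y - z) *
      ((x - y) * (y - z) * (x - z) * e3 + y * (x - z) * (x - y) * e2 - y * (x - y) * (y - z) * e7
        + y * z * (x - z) * e1 - y * z * (x - y) * e4 + y * z * (y - z) * e5
        + y * z * (x - y) * e6)
    - (x - y) *
      ((y - z) * (x - y) * (x - z) * g3 + z * (x - z) * (y - z) * g2 - z * (y - z) * (x - y) * g7
        + z * y * (x - z) * g1 - z * y * (y - z) * g4 + z * z * (x - y) * g5
        + z * z * (y - z) * g6)

/-- `θ_i` as an element of the monoid of self-maps of the polynomial ring. -/
noncomputable def thetaEnd (D : DD n) (i : Idx n) : Function.End (MvPolynomial (Fin n) ℤ) :=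
  thetaOp D i

theorem thetaWord_eq_prod (D : DD n) (w : List (Idx n)) :
    thetaWord D w = (w.map (thetaEnd D)).prod := by
  induction w with
  | nil => rfl
  | cons i w ih =>
    rw [List.map_cons, List.prod_cons, ← ih]
    rfl

/-- `θ_w` depends only on the permutation for which `w` is a reduced word. -/
theorem thetaWord_eq_of_isReducedWord (hD : IsDividedDiff D) {u v : List (Idx n)}
    {σ : Equiv.Perm (Fin n)} (hu : IsReducedWord u σ) (hv : IsReducedWord v σ) :
    thetaWord D u = thetaWord D v := by
  rw [thetaWord_eq_prod, thetaWord_eq_prod]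
  exact matsumoto (thetaEnd D) (fun i j h => funext (thetaOp_comm hD h))
    (fun i j h => funext (thetaOp_braid hD h)) u v σ hu hv

open scoped Classical in
/-- Expansion of `π_w` for an arbitrary word `w`, where `Θ γ` is the common value of `θ_u f` over
the reduced words `u` of `γ`. -/
theorem piWord_eq_sum_subwordProds (hD : IsDividedDiff D) (f : MvPolynomial (Fin n) ℤ)
    (Θ : Equiv.Perm (Fin n) → MvPolynomial (Fin n) ℤ)
    (hΘ : ∀ (u : List (Idx n)) (γ : Equiv.Perm (Fin n)), IsReducedWord u γ →
      thetaWord D u f = Θ γ) (w : List (Idx n)) :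
    piWord D w f = ∑ γ ∈ Finset.univ.filter (· ∈ subwordProds w), Θ γ := by
  induction w with
  | nil =>
    have hnil : Finset.univ.filter (· ∈ subwordProds ([] : List (Idx n))) = {1} := by
      ext γ
      simp [subwordProds, wordProd_nil, eq_comm]
    rw [hnil, Finset.sum_singleton]
    exact hΘ [] 1 ⟨rfl, fun _ _ => Nat.zero_le _⟩
  | cons i w ih =>
    have hasc : ∀ γ ∈ subwordProds w, ¬ IsLeftDescent i γ →
        thetaOp D i (Θ γ) = Θ (simpleT i * γ) := by
      intro γ hγ hi
      obtain ⟨u, hu⟩ := exists_isReducedWord_of_mem_subwordProds hγ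
      rw [← hΘ u γ hu, ← hΘ _ _ (hu.cons hi)]
      rfl
    have hdesc : ∀ γ ∈ subwordProds w, IsLeftDescent i γ → Θ γ + thetaOp D i (Θ γ) = 0 := by
      intro γ hγ hi
      obtain ⟨u, hu⟩ := exists_isReducedWord_of_mem_subwordProds hγ
      obtain ⟨v, -, hv⟩ := hu.exists_cons hi
      rw [← hΘ _ _ hv]
      simp only [thetaWord, thetaOp_thetaOp hD, add_neg_cancel]
    set P := Finset.univ.filter fun γ => γ ∈ subwordProds w ∧ ¬ IsLeftDescent i γ with hP
    have hleft : piWord D (i :: w) f = ∑ γ ∈ P, (Θ γ + Θ (simpleT i * γ)) := by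
      rw [piWord, piOp_eq hD, ih, thetaOp_sum hD, ← Finset.sum_add_distrib,
        ← Finset.sum_filter_add_sum_filter_not _ (IsLeftDescent i), Finset.filter_filter,
        Finset.filter_filter, Finset.sum_eq_zero, zero_add]
      · refine Finset.sum_congr rfl fun γ hγ => ?_
        have h := (Finset.mem_filter.1 hγ).2
        rw [hasc γ h.1 h.2]
      · intro γ hγ
        simp only [Finset.mem_filter, Finset.mem_univ, true_and] at hγ
        exact hdesc γ hγ.1 hγ.2
    rw [hleft, Finset.sum_add_distrib,
      ← Finset.sum_filter_not_add_sum_filter (Finset.univ.filter (· ∈ subwordProds (i :: w)))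
        (IsLeftDescent i), Finset.filter_filter, Finset.filter_filter]
    congr 1
    · refine Finset.sum_congr ?_ fun _ _ => rfl
      ext γ
      simp only [hP, Finset.mem_filter, Finset.mem_univ, true_and, mem_subwordProds_cons]
      refine ⟨fun h => ⟨Or.inl h.1, h.2⟩, fun h => ⟨h.1.elim id fun h1 => ?_, h.2⟩⟩
      have := simpleT_mul_mem_subwordProds h1 ((isLeftDescent_simpleT_mul i γ).2 h.2)
      rwa [simpleT_mul_simpleT_mul] at this
    · refine Finset.sum_nbij' (simpleT i * ·) (simpleT i * ·) ?_ ?_ ?_ ?_ ?_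
      · intro γ hγ
        simp only [hP, Finset.mem_filter, Finset.mem_univ, true_and, mem_subwordProds_cons,
          isLeftDescent_simpleT_mul, simpleT_mul_simpleT_mul] at hγ ⊢
        exact ⟨Or.inr hγ.1, hγ.2⟩
      · intro γ hγ
        simp only [hP, Finset.mem_filter, Finset.mem_univ, true_and, mem_subwordProds_cons,
          isLeftDescent_simpleT_mul, not_not] at hγ ⊢
        exact ⟨hγ.1.elim (fun h => simpleT_mul_mem_subwordProds h hγ.2) id, hγ.2⟩
      · exact fun γ _ => simpleT_mul_simpleT_mul i γ
      · exact fun γ _ => simpleT_mul_simpleT_mul i γ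
      · exact fun _ _ => rfl

end Operators

open scoped Classical in
/-- `π_σ = ∑_{γ ≤ σ} θ_γ`. -/
theorem stmt7 (n : ℕ) (D : DD n) (hD : IsDividedDiff D)
    (σ : Equiv.Perm (Fin n)) (w : List (Idx n)) (hw : IsReducedWord w σ)
    (r : Equiv.Perm (Fin n) → List (Idx n))
    (hr : ∀ γ : Equiv.Perm (Fin n), BruhatLE γ σ → IsReducedWord (r γ) γ)
    (f : MvPolynomial (Fin n) ℤ) :
    piWord D w f =
      ∑ γ ∈ Finset.univ.filter (fun γ : Equiv.Perm (Fin n) => BruhatLE γ σ),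
        thetaWord D (r γ) f := by
  have hΘ : ∀ (u : List (Idx n)) (γ : Equiv.Perm (Fin n)) (hu : IsReducedWord u γ),
      thetaWord D u f =
        if h : ∃ v, IsReducedWord v γ then thetaWord D h.choose f else 0 := by
    intro u γ hu
    have h : ∃ v, IsReducedWord v γ := ⟨u, hu⟩
    rw [dif_pos h, thetaWord_eq_of_isReducedWord hD hu h.choose_spec]
  rw [piWord_eq_sum_subwordProds hD f _ hΘ w]
  refine Finset.sum_congr ?_ fun γ hγ => (hΘ _ _ (hr γ (Finset.mem_filter.1 hγ).2)).symm
  ext γ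
  simp only [Finset.mem_filter, Finset.mem_univ, true_and, bruhatLE_iff_mem_subwordProds hw]
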